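/- (Proposition 6: stability of the finite difference iteration.) Assume δ > 2Ū and set K = δ + √(δ(δ − 2Ū)). Let 0 < Δt < 1/(δ + K). Let μ₀ be a nonnegative matrix with Σ_{i=1}^{N_x} (μ₀)_{i,j} = 1 for every j, and for each n ∈ ℕ let U^{(n)} be a matrix with 0 ≤ U^{(n)}_{i,j} ≤ Ū for all (i,j). Define sequences of matrices by m^{(0)}, Φ^{(0)} satisfying m^{(0)}_{i,j} ≥ 0 for all (i,j), Σ_{i=1}^{N_x} m^{(0)}_{i,j} = 1 for every j, and 0 ≤ Φ^{(0)}_{i,j} ≤ K for all (i,j), and by the recursions Φ^{(n+1)}_{i,j} = Φ^{(n)}_{i,j} + δ Δt · H^{(n)}_{i,j}(m^{(n)}, Φ^{(n)}) and m^{(n+1)}_{i,j} = m^{(n)}_{i,j} + Δt · F_{i,j}(m^{(n)}, Φ^{(n)}), where H^{(n)} uses the utility matrix U^{(n)}. Then for every n ∈ ℕ: m^{(n)}_{i,j} ≥ 0 at all (i,j); 0 ≤ Φ^{(n)}_{i,j} ≤ K at all (i,j); and Σ_{i=1}^{N_x} m^{(n)}_{i,j} = 1 for every j. -/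

import Mathlib

/-- Discretized Fokker–Planck operator:
`F_{i,j}(m, Φ) = δ (μ₀)_{i,j} − (δ − (Φ_{i,j} − Σ_k Φ_{k,j} m_{k,j})) m_{i,j}`. -/
def Fop {Nx Ny : ℕ} (δ : ℝ) (μ0 m Φ : Fin Nx → Fin Ny → ℝ)
    (i : Fin Nx) (j : Fin Ny) : ℝ :=
  δ * μ0 i j - (δ - (Φ i j - ∑ k, Φ k j * m k j)) * m i j

/-- Discretized HJB operator:
`H_{i,j}(m, Φ) = −Φ_{i,j} + U_{i,j} + (1/(2δ)) Σ_k ((Φ_{k,j} − Φ_{i,j})₊)² m_{k,j}`. -/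
noncomputable def Hop {Nx Ny : ℕ} (δ : ℝ) (Umat m Φ : Fin Nx → Fin Ny → ℝ)
    (i : Fin Nx) (j : Fin Ny) : ℝ :=
  -Φ i j + Umat i j + (1 / (2 * δ)) * ∑ k, (max (Φ k j - Φ i j) 0) ^ 2 * m k j

/-- **Proposition 6: stability of the finite difference iteration.** -/
theorem stmt14
    (Nx Ny : ℕ) [NeZero Nx] [NeZero Ny]
    (Ubar δ : ℝ) (hUbar : 0 < Ubar) (hδ : 2 * Ubar < δ)
    (K : ℝ) (hK : K = δ + Real.sqrt (δ * (δ - 2 * Ubar)))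
    (Δt : ℝ) (hΔt0 : 0 < Δt) (hΔt : Δt < 1 / (δ + K))
    (μ0 : Fin Nx → Fin Ny → ℝ)
    (hμ0 : ∀ i j, 0 ≤ μ0 i j) (hμ0s : ∀ j, ∑ i, μ0 i j = 1)
    (Useq : ℕ → Fin Nx → Fin Ny → ℝ)
    (hU : ∀ n i j, 0 ≤ Useq n i j ∧ Useq n i j ≤ Ubar)
    (mseq Φseq : ℕ → Fin Nx → Fin Ny → ℝ)
    (hm0 : ∀ i j, 0 ≤ mseq 0 i j) (hms0 : ∀ j, ∑ i, mseq 0 i j = 1)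
    (hΦ0 : ∀ i j, 0 ≤ Φseq 0 i j ∧ Φseq 0 i j ≤ K)
    (hΦrec : ∀ n i j, Φseq (n + 1) i j =
      Φseq n i j + δ * Δt * Hop δ (Useq n) (mseq n) (Φseq n) i j)
    (hmrec : ∀ n i j, mseq (n + 1) i j =
      mseq n i j + Δt * Fop δ μ0 (mseq n) (Φseq n) i j) :
    ∀ n : ℕ, (∀ i j, 0 ≤ mseq n i j) ∧
      (∀ i j, 0 ≤ Φseq n i j ∧ Φseq n i j ≤ K) ∧
      (∀ j, ∑ i, mseq n i j = 1) := by
  have hδ0 : 0 < δ := by linarith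
  have harg : 0 ≤ δ * (δ - 2 * Ubar) := mul_nonneg hδ0.le (by linarith)
  have hs := Real.sq_sqrt harg
  have hs0 := Real.sqrt_nonneg (δ * (δ - 2 * Ubar))
  have hKδ : δ ≤ K := by linarith
  have hKq : K ^ 2 - 2 * δ * K + 2 * δ * Ubar = 0 := by
    have : K - δ = Real.sqrt (δ * (δ - 2 * Ubar)) := by linarith
    rw [← this] at hs
    linarith
  have hdt : Δt * (δ + K) < 1 := by
    rwa [lt_div_iff₀ (by linarith)] at hΔt
  have hdtδ : Δt * δ ≤ 1 := by nlinarith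
  intro n
  induction n with
  | zero => exact ⟨hm0, hΦ0, hms0⟩
  | succ n ih =>
    obtain ⟨hm, hΦ, hms⟩ := ih
    refine ⟨?_, ?_, ?_⟩
    · intro i j
      rw [hmrec, Fop]
      have havg : ∑ k, Φseq n k j * mseq n k j ≤ K := by
        calc ∑ k, Φseq n k j * mseq n k j ≤ ∑ k, K * mseq n k j :=
              Finset.sum_le_sum fun k _ => mul_le_mul_of_nonneg_right (hΦ k j).2 (hm k j)
          _ = K := by rw [← Finset.mul_sum, hms, mul_one]
      generalize ∑ k, Φseq n k j * mseq n k j = A at *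
      have h1 : 0 ≤ 1 - Δt * (δ - (Φseq n i j - A)) := by
        have : Δt * (δ - (Φseq n i j - A)) ≤ Δt * (δ + K) :=
          mul_le_mul_of_nonneg_left (by linarith [(hΦ i j).1]) hΔt0.le
        linarith
      have h2 := mul_nonneg h1 (hm i j)
      have h3 := mul_nonneg hΔt0.le (mul_nonneg hδ0.le (hμ0 i j))
      linarith
    · intro i j
      rw [hΦrec, Hop]
      obtain ⟨hp0, hpK⟩ := hΦ i j
      obtain ⟨hU0, hU1⟩ := hU n i j
      have hS0 : 0 ≤ ∑ k, (max (Φseq n k j - Φseq n i j) 0) ^ 2 * mseq n k j :=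
        Finset.sum_nonneg fun k _ => mul_nonneg (sq_nonneg _) (hm k j)
      have hS1 : ∑ k, (max (Φseq n k j - Φseq n i j) 0) ^ 2 * mseq n k j
          ≤ (K - Φseq n i j) ^ 2 := by
        calc _ ≤ ∑ k, (K - Φseq n i j) ^ 2 * mseq n k j :=
              Finset.sum_le_sum fun k _ => mul_le_mul_of_nonneg_right
                (pow_le_pow_left₀ (le_max_right _ _)
                  (max_le (by linarith [(hΦ k j).2]) (by linarith)) 2) (hm k j)
          _ = _ := by rw [← Finset.mul_sum, hms, mul_one]
      generalize ∑ k, (max (Φseq n k j - Φseq n i j) 0) ^ 2 * mseq n k j = S at *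
      generalize Φseq n i j = p at *
      generalize Useq n i j = u at *
      have e : p + δ * Δt * (-p + u + 1 / (2 * δ) * S)
          = (1 - Δt * δ) * p + Δt * δ * u + Δt * S / 2 := by
        field_simp
        ring
      rw [e]
      have h1 : 0 ≤ 1 - Δt * δ := by linarith
      have hd : 0 ≤ Δt * δ := by positivity
      constructor
      · positivity
      · have a1 := mul_nonneg h1 (sub_nonneg.2 hpK)
        have a2 := mul_le_mul_of_nonneg_left hU1 hd
        have a3 := mul_le_mul_of_nonneg_left hS1 hΔt0.le
        have a4 : Δt * (K ^ 2 - 2 * δ * K + 2 * δ * Ubar) = 0 := by rw [hKq, mul_zero]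
        have a5 : 0 ≤ Δt * (p * (2 * K - p)) :=
          mul_nonneg hΔt0.le (mul_nonneg hp0 (by linarith))
        linarith
    · intro j
      simp only [hmrec, Fop]
      have e : ∀ i, mseq n i j + Δt * (δ * μ0 i j
          - (δ - (Φseq n i j - ∑ k, Φseq n k j * mseq n k j)) * mseq n i j)
          = (1 - Δt * δ - Δt * ∑ k, Φseq n k j * mseq n k j) * mseq n i j
            + Δt * δ * μ0 i j + Δt * (Φseq n i j * mseq n i j) := fun i => by ring
      simp only [e, Finset.sum_add_distrib, ← Finset.mul_sum, hms, hμ0s]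
      ring
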